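/- arXiv:cs/9809118 — 4 statements merged into one kernel-verified Lean document; each statement's English description precedes it below -/
import Mathlib

section
/- For every language L over a finite alphabet A: L = ⋃_{m≥0} (L^+(2m) \ L^+(2m+1)), and the complement of L equals (A* \ L^+(0)) ∪ ⋃_{m≥1} (L^+(2m−1) \ L^+(2m)). Dually, A* \ L = ⋃_{m≥0} (L^-(2m) \ L^-(2m+1)) and L = (A* \ L^-(0)) ∪ ⋃_{m≥1} (L^-(2m−1) \ L^-(2m)). -/
/-- `LPlus L m` is the set of words `v` reachable from some `w₀ ∈ L` by an
`m`-alternating word extension chain with respect to `L`: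
`w₀ ⊑ w₁ ⊑ ⋯ ⊑ w_m ⊑ v`, `w₀ ∈ L`, and `wᵢ ∈ L ↔ w_{i+1} ∉ L` for `i < m`. -/
def LPlus {A : Type*} (L : Set (List A)) (m : ℕ) : Set (List A) :=
  {v | ∃ c : ℕ → List A, c 0 ∈ L ∧ (∀ i < m, (c i).Sublist (c (i + 1))) ∧
    (c m).Sublist v ∧ ∀ i < m, (c i ∈ L ↔ c (i + 1) ∉ L)}

/-- `LMinus L m` is defined like `LPlus L m` but requiring `w₀ ∉ L`. -/
def LMinus {A : Type*} (L : Set (List A)) (m : ℕ) : Set (List A) :=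
  {v | ∃ c : ℕ → List A, c 0 ∉ L ∧ (∀ i < m, (c i).Sublist (c (i + 1))) ∧
    (c m).Sublist v ∧ ∀ i < m, (c i ∈ L ↔ c (i + 1) ∉ L)}

theorem lMinus_eq_lPlus_compl {A : Type*} (L : Set (List A)) (m : ℕ) :
    LMinus L m = LPlus Lᶜ m := by
  ext v
  simp only [LMinus, LPlus, Set.mem_ofPred_eq, Set.mem_compl_iff]
  refine exists_congr fun c => and_congr_right fun _ => and_congr_right fun _ =>
    and_congr_right fun _ => forall₂_congr fun i _ => ?_
  tauto

/-- Membership of the words of an alternating chain starting in `L` is governed by parity. -/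
theorem mem_iff_even_of_alternating {A : Type*} {L : Set (List A)} {c : ℕ → List A} {m : ℕ}
    (h0 : c 0 ∈ L) (h : ∀ i < m, (c i ∈ L ↔ c (i + 1) ∉ L)) :
    ∀ i ≤ m, (c i ∈ L ↔ Even i) := by
  intro i
  induction i with
  | zero => simp [h0]
  | succ i ih =>
    intro hi
    have h1 := ih (by omega)
    have h2 := h i (by omega)
    rw [Nat.even_add_one]
    tauto

theorem length_ge_of_alternating {A : Type*} {L : Set (List A)} {c : ℕ → List A} {m : ℕ}
    (hs : ∀ i < m, (c i).Sublist (c (i + 1))) (h : ∀ i < m, (c i ∈ L ↔ c (i + 1) ∉ L)) :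
    ∀ i ≤ m, i ≤ (c i).length := by
  intro i
  induction i with
  | zero => simp
  | succ i ih =>
    intro hi
    have h1 := ih (by omega)
    have h2 := h i (by omega)
    have h3 := hs i (by omega)
    have h4 : (c i).length ≠ (c (i + 1)).length := by
      intro he
      rw [h3.eq_of_length he] at h2
      tauto
    have := h3.length_le
    omega

theorem le_length_of_mem_lPlus {A : Type*} {L : Set (List A)} {m : ℕ} {v : List A}
    (hv : v ∈ LPlus L m) : m ≤ v.length := by
  obtain ⟨c, -, hs, hcv, h⟩ := hv
  exact (length_ge_of_alternating hs h m le_rfl).trans hcv.length_le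

theorem mem_lPlus_zero_of_mem {A : Type*} {L : Set (List A)} {v : List A} (hv : v ∈ L) :
    v ∈ LPlus L 0 :=
  ⟨fun _ => v, hv, by simp, List.Sublist.refl v, by simp⟩

/-- The longest alternating chain below `v` determines whether `v` belongs to `L`. -/
theorem mem_iff_even_of_mem_lPlus_diff {A : Type*} {L : Set (List A)} {m : ℕ} {v : List A}
    (hv : v ∈ LPlus L m \ LPlus L (m + 1)) : v ∈ L ↔ Even m := by
  obtain ⟨⟨c, h0, hs, hcv, h⟩, hn⟩ := hv
  have hp := mem_iff_even_of_alternating h0 h m le_rfl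
  by_contra hne
  refine hn ⟨fun i => if i ≤ m then c i else v, by simpa using h0, fun i hi => ?_, by simp,
    fun i hi => ?_⟩ <;> rcases Nat.lt_succ_iff_lt_or_eq.mp hi with hi | rfl
  · simpa [hi.le, Nat.succ_le_of_lt hi] using hs i hi
  · simpa using hcv
  · simpa [hi.le, Nat.succ_le_of_lt hi] using h i hi
  · simp only [le_refl, if_true, Nat.not_succ_le_self, if_false]
    tauto

theorem exists_mem_lPlus_diff {A : Type*} {L : Set (List A)} {v : List A}
    (hv : v ∈ LPlus L 0) : ∃ m, v ∈ LPlus L m \ LPlus L (m + 1) := by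
  by_contra! hc
  have hall : ∀ m, v ∈ LPlus L m := fun m => by
    induction m with
    | zero => exact hv
    | succ m ih => exact not_not.mp fun hn => hc m ⟨ih, hn⟩
  have := le_length_of_mem_lPlus (hall (v.length + 1))
  omega

theorem eq_iUnion_lPlus_diff {A : Type*} (L : Set (List A)) :
    L = ⋃ m : ℕ, LPlus L (2 * m) \ LPlus L (2 * m + 1) := by
  ext v
  rw [Set.mem_iUnion]
  refine ⟨fun hv => ?_, fun ⟨m, hm⟩ => (mem_iff_even_of_mem_lPlus_diff hm).mpr (even_two_mul m)⟩
  obtain ⟨m, hm⟩ := exists_mem_lPlus_diff (mem_lPlus_zero_of_mem hv)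
  obtain ⟨k, rfl⟩ := even_iff_exists_two_mul.mp ((mem_iff_even_of_mem_lPlus_diff hm).mp hv)
  exact ⟨k, hm⟩

theorem compl_eq_union_iUnion_lPlus_diff {A : Type*} (L : Set (List A)) :
    Lᶜ = (LPlus L 0)ᶜ ∪ ⋃ m : ℕ, LPlus L (2 * m + 1) \ LPlus L (2 * m + 2) := by
  ext v
  rw [Set.mem_union, Set.mem_iUnion]
  constructor
  · intro hv
    by_cases h0 : v ∈ LPlus L 0
    · obtain ⟨m, hm⟩ := exists_mem_lPlus_diff h0
      have hodd : ¬ Even m := fun he => hv ((mem_iff_even_of_mem_lPlus_diff hm).mpr he)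
      obtain ⟨k, rfl⟩ := Nat.not_even_iff_odd.mp hodd
      exact Or.inr ⟨k, hm⟩
    · exact Or.inl h0
  · rintro (h0 | ⟨m, hm⟩) hv
    · exact h0 (mem_lPlus_zero_of_mem hv)
    · exact Nat.not_even_two_mul_add_one m ((mem_iff_even_of_mem_lPlus_diff hm).mp hv)

/-- `L = ⋃_m (L⁺(2m) \ L⁺(2m+1))`,
`Lᶜ = (A* \ L⁺(0)) ∪ ⋃_{m≥1} (L⁺(2m−1) \ L⁺(2m))`, and dually with `L⁻`. -/
theorem stmt5 {A : Type*} [Fintype A] (L : Set (List A)) :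
    (L = ⋃ m : ℕ, LPlus L (2 * m) \ LPlus L (2 * m + 1)) ∧
    (Lᶜ = (LPlus L 0)ᶜ ∪ ⋃ m : ℕ, LPlus L (2 * m + 1) \ LPlus L (2 * m + 2)) ∧
    (Lᶜ = ⋃ m : ℕ, LMinus L (2 * m) \ LMinus L (2 * m + 1)) ∧
    (L = (LMinus L 0)ᶜ ∪ ⋃ m : ℕ, LMinus L (2 * m + 1) \ LMinus L (2 * m + 2)) := by
  simp only [lMinus_eq_lPlus_compl]
  refine ⟨eq_iUnion_lPlus_diff L, compl_eq_union_iUnion_lPlus_diff L,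
    eq_iUnion_lPlus_diff Lᶜ, ?_⟩
  simpa only [compl_compl] using compl_eq_union_iUnion_lPlus_diff Lᶜ
end

section
/- Let A be a finite alphabet, L a language over A, and k ≥ 1. Then L ∈ co-L_{1/2}(k) (i.e., the complement A* \ L belongs to L_{1/2}(k)) if and only if L is regular and m^-(L) < k (equivalently, L^-(k) = ∅). -/
/-- A language is regular iff it is accepted by a DFA with a finite state set. -/
def RegularLang {A : Type*} (L : Set (List A)) : Prop :=
  ∃ (σ : Type) (_ : Fintype σ) (M : DFA A σ), ∀ w : List A, M.eval w ∈ M.accept ↔ w ∈ L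

/-- The class `L_{1/2}`: finite unions of sets `⟦w⟧ = {v | w ⊑ v}`. -/
def LhalfClass (A : Type*) : Set (Set (List A)) :=
  {L | ∃ W : Finset (List A), L = ⋃ w ∈ W, {v : List A | w.Sublist v}}

/-- `m⁺(L) = sup {m | L⁺(m) ≠ ∅}`, taken in `ℕ∞ = ℕ ∪ {∞}`. -/
noncomputable def mPlus {A : Type*} (L : Set (List A)) : ℕ∞ :=
  ⨆ m ∈ {m : ℕ | (LPlus L m).Nonempty}, (m : ℕ∞)

/-- `m⁻(L) = sup {m | L⁻(m) ≠ ∅}`, taken in `ℕ∞ = ℕ ∪ {∞}`. -/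
noncomputable def mMinus {A : Type*} (L : Set (List A)) : ℕ∞ :=
  ⨆ m ∈ {m : ℕ | (LMinus L m).Nonempty}, (m : ℕ∞)

/-- The `k`-th level of the boolean hierarchy over a class `C`:
`C(k) = {L₁ Δ L₂ Δ ⋯ Δ L_k | L₁, …, L_k ∈ C}` (`Δ` is symmetric difference). -/
def boolLevel {X : Type*} (C : Set (Set X)) (k : ℕ) : Set (Set X) :=
  {L | ∃ Ls : List (Set X), Ls.length = k ∧ (∀ M ∈ Ls, M ∈ C) ∧
    L = Ls.foldr symmDiff ∅}

namespace List

theorem exists_suffix_sublist_append_iff {A : Type*} (x w : List A) :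
    ∃ s, s <:+ w ∧ ∀ y, w.Sublist (x ++ y) ↔ s.Sublist y := by
  induction x generalizing w with
  | nil => exact ⟨w, suffix_rfl, fun y => Iff.rfl⟩
  | cons a x ih =>
    cases w with
    | nil => exact ⟨[], suffix_rfl, fun y => by simp⟩
    | cons b w =>
      by_cases h : b = a
      · subst h
        obtain ⟨s, hs, h⟩ := ih w
        exact ⟨s, hs.trans (suffix_cons _ _), fun y => by
          rw [cons_append, cons_sublist_cons, h]⟩
      · obtain ⟨s, hs, h'⟩ := ih (b :: w)
        refine ⟨s, hs, fun y => ?_⟩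
        rw [← h', cons_append]
        refine ⟨fun hsub => ?_, fun hsub => hsub.cons a⟩
        cases hsub with
        | cons _ h => exact h
        | cons_cons => exact absurd rfl h

theorem countP_lt_range (n k : ℕ) : (range k).countP (fun j => decide (j < n)) = min k n := by
  induction k with
  | zero => simp
  | succ k ih =>
    rw [range_succ, countP_append, ih]
    by_cases h : k < n <;> simp [h] <;> omega

open Classical in
theorem mem_foldr_symmDiff {X : Type*} (Ls : List (Set X)) (v : X) :
    v ∈ Ls.foldr symmDiff ∅ ↔ Odd (Ls.countP (fun M => decide (v ∈ M))) := by
  induction Ls with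
  | nil => simp
  | cons M Ls ih =>
    rw [foldr_cons, Set.mem_symmDiff, ih, countP_cons]
    by_cases h : v ∈ M <;> simp [h, Nat.odd_add_one]

/-- Higman's lemma for the scattered subword order on a finite alphabet. -/
theorem partiallyWellOrderedOn_sublist {A : Type*} [Finite A] (U : Set (List A)) :
    U.PartiallyWellOrderedOn List.Sublist := by
  have huniv : (Set.univ : Set A).PartiallyWellOrderedOn (· = ·) :=
    Set.finite_univ.partiallyWellOrderedOn
  rw [Set.partiallyWellOrderedOn_iff_exists_lt]
  intro f _
  obtain ⟨m, n, hmn, hs⟩ :=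
    (Set.PartiallyWellOrderedOn.partiallyWellOrderedOn_sublistForall₂ _ huniv).exists_lt
      (f := f) (by simp)
  refine ⟨m, n, hmn, ?_⟩
  obtain ⟨l, hl, hs⟩ := sublistForall₂_iff.1 hs
  rw [forall₂_eq_eq_eq] at hl
  exact hl ▸ hs

end List

theorem regularLang_iff_exists_isRegular {A : Type*} {L : Set (List A)} :
    RegularLang L ↔ ∃ K : Language A, K.IsRegular ∧ ∀ w, w ∈ K ↔ w ∈ L := by
  constructor
  · rintro ⟨σ, hσ, M, hM⟩
    exact ⟨M.accepts, ⟨σ, hσ, M, rfl⟩, hM⟩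
  · rintro ⟨_, ⟨σ, hσ, M, rfl⟩, hM⟩
    exact ⟨σ, hσ, M, hM⟩

theorem regularLang_empty {A : Type*} : RegularLang (∅ : Set (List A)) :=
  ⟨Unit, inferInstance, ⟨fun _ _ => (), (), ∅⟩, fun _ => Iff.rfl⟩

theorem RegularLang.compl {A : Type*} {L : Set (List A)} (hL : RegularLang L) :
    RegularLang Lᶜ := by
  obtain ⟨σ, hσ, M, hM⟩ := hL
  exact ⟨σ, hσ, ⟨M.step, M.start, M.acceptᶜ⟩, fun w => not_congr (hM w)⟩

theorem RegularLang.union {A : Type*} {L₁ L₂ : Set (List A)} (h₁ : RegularLang L₁)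
    (h₂ : RegularLang L₂) : RegularLang (L₁ ∪ L₂) := by
  rw [regularLang_iff_exists_isRegular] at *
  obtain ⟨K₁, hK₁, h₁⟩ := h₁
  obtain ⟨K₂, hK₂, h₂⟩ := h₂
  exact ⟨K₁ + K₂, hK₁.add hK₂, fun w => by rw [Language.mem_add, h₁, h₂, Set.mem_union]⟩

theorem RegularLang.symmDiff {A : Type*} {L₁ L₂ : Set (List A)} (h₁ : RegularLang L₁)
    (h₂ : RegularLang L₂) : RegularLang (symmDiff L₁ L₂) := by
  have h : _root_.symmDiff L₁ L₂ = (L₁ᶜ ∪ L₂)ᶜ ∪ (L₂ᶜ ∪ L₁)ᶜ := by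
    ext w
    simp only [Set.mem_symmDiff, Set.mem_union, Set.mem_compl_iff]
    tauto
  rw [h]
  exact (h₁.compl.union h₂).compl.union (h₂.compl.union h₁).compl

theorem regularLang_setOf_sublist {A : Type*} (w : List A) :
    RegularLang {v | w.Sublist v} := by
  rw [regularLang_iff_exists_isRegular]
  let K : List A → Language A := fun s => {v | s.Sublist v}
  refine ⟨K w, Language.IsRegular.of_finite_range_leftQuotient ?_, fun _ => Iff.rfl⟩
  refine ((List.finite_toSet w.tails).image K).subset ?_
  rintro _ ⟨x, rfl⟩
  obtain ⟨s, hs, h⟩ := List.exists_suffix_sublist_append_iff x w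
  exact ⟨s, (List.mem_tails _ _).2 hs, Language.ext fun y => (h y).symm⟩

theorem regularLang_of_mem_LhalfClass {A : Type*} {L : Set (List A)} (hL : L ∈ LhalfClass A) :
    RegularLang L := by
  classical
  obtain ⟨W, rfl⟩ := hL
  induction W using Finset.induction_on with
  | empty => simpa using regularLang_empty
  | insert w W _ ih =>
    rw [Finset.set_biUnion_insert]
    exact (regularLang_setOf_sublist w).union ih

theorem regularLang_foldr_symmDiff {A : Type*} (Ls : List (Set (List A)))
    (h : ∀ M ∈ Ls, RegularLang M) : RegularLang (Ls.foldr symmDiff ∅) := by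
  induction Ls with
  | nil => exact regularLang_empty
  | cons M Ls ih =>
    rw [List.forall_mem_cons] at h
    exact h.1.symmDiff (ih h.2)

theorem mem_LhalfClass_of_upward_closed {A : Type*} [Finite A] {U : Set (List A)}
    (hU : ∀ w v, w ∈ U → w.Sublist v → v ∈ U) : U ∈ LhalfClass A := by
  let W : Set (List A) := {w ∈ U | ∀ w' ∈ U, w'.Sublist w → w' = w}
  have hfin : W.Finite := by
    refine IsAntichain.finite_of_partiallyWellOrderedOn (fun a ha b hb hab hs => ?_)
      (List.partiallyWellOrderedOn_sublist W)
    exact hab (hb.2 a ha.1 hs)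
  refine ⟨hfin.toFinset, Set.ext fun v => ?_⟩
  simp only [Set.mem_iUnion, Set.Finite.mem_toFinset, exists_prop, Set.mem_ofPred_eq]
  refine ⟨fun hv => ?_, fun ⟨w, hw, hs⟩ => hU w v hw.1 hs⟩
  induction hn : v.length using Nat.strong_induction_on generalizing v with
  | _ n ih =>
    by_cases hmin : ∀ w' ∈ U, w'.Sublist v → w' = v
    · exact ⟨v, ⟨hv, hmin⟩, List.Sublist.refl v⟩
    · push Not at hmin
      obtain ⟨w', hw', hs, hne⟩ := hmin
      have hlt : w'.length < n :=
        hn ▸ lt_of_le_of_ne hs.length_le fun he => hne (hs.eq_of_length he)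
      obtain ⟨w, hw, hws⟩ := ih _ hlt w' hw' rfl
      exact ⟨w, hw, hws.trans hs⟩

theorem upward_closed_of_mem_LhalfClass {A : Type*} {U : Set (List A)} (hU : U ∈ LhalfClass A)
    {w v : List A} (hw : w ∈ U) (hs : w.Sublist v) : v ∈ U := by
  obtain ⟨W, rfl⟩ := hU
  simp only [Set.mem_iUnion, exists_prop, Set.mem_ofPred_eq] at hw ⊢
  obtain ⟨u, hu, huw⟩ := hw
  exact ⟨u, hu, huw.trans hs⟩

theorem LMinus_upward_closed {A : Type*} (L : Set (List A)) (m : ℕ) (w v : List A)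
    (hw : w ∈ LMinus L m) (hs : w.Sublist v) : v ∈ LMinus L m := by
  obtain ⟨c, h0, h1, h2, h3⟩ := hw
  exact ⟨c, h0, h1, h2.trans hs, h3⟩

theorem LMinus_antitone {A : Type*} (L : Set (List A)) : Antitone (LMinus L) := by
  refine antitone_nat_of_succ_le fun m v ⟨c, h0, h1, h2, h3⟩ => ?_
  exact ⟨c, h0, fun i hi => h1 i (by omega), (h1 m (by omega)).trans h2,
    fun i hi => h3 i (by omega)⟩

theorem mMinus_lt_iff {A : Type*} (L : Set (List A)) {k : ℕ} (hk : 1 ≤ k) :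
    mMinus L < (k : ℕ∞) ↔ LMinus L k = ∅ := by
  constructor
  · intro h
    by_contra hne
    exact absurd h (not_lt.2 (le_iSup₂_of_le (f := fun (m : ℕ) (_ : m ∈ {m | (LMinus L m).Nonempty})
      => (m : ℕ∞)) k (Set.nonempty_iff_ne_empty.2 hne) le_rfl))
  · intro h
    refine lt_of_le_of_lt (b := ((k - 1 : ℕ) : ℕ∞)) (iSup₂_le fun m hm => ?_)
      (Nat.cast_lt.2 (by omega))
    have hlt : m < k := by
      by_contra hle
      obtain ⟨v, hv⟩ := hm
      exact (h ▸ LMinus_antitone L (not_lt.1 hle) hv : v ∈ (∅ : Set (List A)))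
    exact Nat.cast_le.2 (by omega)

theorem LMinus_eq_empty_of_mem_boolLevel {A : Type*} {L : Set (List A)} {k : ℕ}
    (hL : Lᶜ ∈ boolLevel (LhalfClass A) k) : LMinus L k = ∅ := by
  classical
  obtain ⟨Ls, rfl, hC, hL⟩ := hL
  refine Set.eq_empty_of_forall_notMem fun v ⟨c, h0, h1, _, h3⟩ => ?_
  let N : List A → ℕ := fun w => Ls.countP fun M => decide (w ∈ M)
  have hN : ∀ w, w ∉ L ↔ Odd (N w) := fun w => by
    rw [← List.mem_foldr_symmDiff, ← hL, Set.mem_compl_iff]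
  have hmono : ∀ i < Ls.length, N (c i) ≤ N (c (i + 1)) := fun i hi =>
    List.countP_mono_left fun M hM h => by
      simp only [decide_eq_true_eq] at h ⊢
      exact upward_closed_of_mem_LhalfClass (hC M hM) h (h1 i hi)
  have hlt : ∀ i ≤ Ls.length, i < N (c i) := by
    intro i
    induction i with
    | zero => exact fun _ => ((hN _).1 h0).pos
    | succ i ih =>
      intro hi
      have hlt := ih (by omega)
      have hle := hmono i (by omega)
      have hne : N (c i) ≠ N (c (i + 1)) := fun he => by
        have := h3 i (by omega)
        rw [hN, ← he, ← hN] at this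
        tauto
      omega
  exact absurd (hlt _ le_rfl) (not_lt.2 List.countP_le_length)

theorem notMem_iff_even_of_alternating {A : Type*} {L : Set (List A)} {c : ℕ → List A} {m : ℕ}
    (h0 : c 0 ∉ L) (h : ∀ i < m, (c i ∈ L ↔ c (i + 1) ∉ L)) : c m ∉ L ↔ Even m := by
  induction m with
  | zero => simpa using h0
  | succ m ih =>
    rw [← h m (by omega), Nat.even_add_one, ← ih fun i hi => h i (by omega), not_not]

theorem notMem_iff_odd {A : Type*} {L : Set (List A)} {v : List A} {n : ℕ}
    (hn : ∀ j, v ∈ LMinus L j ↔ j < n) : v ∉ L ↔ Odd n := by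
  cases n with
  | zero =>
    have : v ∉ LMinus L 0 := by simp [hn]
    simp only [Nat.not_odd_zero, iff_false, not_not]
    by_contra hv
    exact this ⟨fun _ => v, hv, by simp, List.Sublist.refl v, by simp⟩
  | succ m =>
    obtain ⟨c, h0, h1, h2, h3⟩ := (hn m).2 (by omega)
    have hv : v ∉ LMinus L (m + 1) := by simp [hn]
    have hcv : c m ∈ L ↔ v ∈ L := by
      by_contra hne
      refine hv ⟨fun i => if i ≤ m then c i else v, by simpa, fun i hi => ?_, by simp,
        fun i hi => ?_⟩
      · rcases Nat.lt_succ_iff_lt_or_eq.1 hi with hi | rfl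
        · simpa [hi.le, Nat.succ_le_iff.2 hi] using h1 i hi
        · simpa using h2
      · rcases Nat.lt_succ_iff_lt_or_eq.1 hi with hi | rfl
        · simpa [hi.le, Nat.succ_le_iff.2 hi] using h3 i hi
        · simp only [le_refl, if_true, Nat.not_succ_le_self, if_false]
          tauto
    rw [← hcv, notMem_iff_even_of_alternating h0 h3, Nat.odd_add_one, Nat.not_odd_iff_even]

theorem compl_mem_boolLevel_of_LMinus_eq_empty {A : Type*} [Finite A] {L : Set (List A)} {k : ℕ}
    (h : LMinus L k = ∅) : Lᶜ ∈ boolLevel (LhalfClass A) k := by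
  classical
  refine ⟨(List.range k).map (LMinus L), by simp, ?_, Set.ext fun v => ?_⟩
  · rw [List.forall_mem_map]
    exact fun j _ => mem_LhalfClass_of_upward_closed (LMinus_upward_closed L j)
  · have hex : ∃ j, v ∉ LMinus L j := ⟨k, by simp [h]⟩
    have hn : ∀ j, v ∈ LMinus L j ↔ j < Nat.find hex := fun j => by
      rw [Nat.lt_find_iff]
      exact ⟨fun hj i hi => not_not.2 (LMinus_antitone L hi hj), fun hj => not_not.1 (hj j le_rfl)⟩
    have hle : Nat.find hex ≤ k := Nat.find_min' hex (by simp [h])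
    rw [List.mem_foldr_symmDiff, List.countP_map, Set.mem_compl_iff, notMem_iff_odd hn]
    generalize Nat.find hex = n at hn hle
    simp only [Function.comp_def, hn]
    rw [List.countP_lt_range, min_eq_right hle]

/-- For `k ≥ 1`: `L ∈ co-L_{1/2}(k)` (i.e. `Lᶜ ∈ L_{1/2}(k)`) iff `L` is regular
and `m⁻(L) < k`. -/
theorem stmt10 {A : Type*} [Fintype A] (L : Set (List A)) (k : ℕ) (hk : 1 ≤ k) :
    Lᶜ ∈ boolLevel (LhalfClass A) k ↔ (RegularLang L ∧ mMinus L < (k : ℕ∞)) := by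
  rw [mMinus_lt_iff L hk]
  refine ⟨fun h => ⟨?_, LMinus_eq_empty_of_mem_boolLevel h⟩,
    fun h => compl_mem_boolLevel_of_LMinus_eq_empty h.2⟩
  obtain ⟨Ls, -, hC, hL⟩ := h
  rw [← compl_compl L, hL]
  exact (regularLang_foldr_symmDiff Ls fun M hM => regularLang_of_mem_LhalfClass (hC M hM)).compl
end

section
/- Let F be a deterministic finite automaton over a finite alphabet A. Then L(F) ∈ L_1 = BC(L_{1/2}) if and only if F does not have pattern P_3. -/
/-- The boolean closure of a class `C`: the smallest class containing `C`
and closed under finite union, finite intersection and complementation. -/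
inductive BoolClosure {X : Type*} (C : Set (Set X)) : Set X → Prop
  | base : ∀ L ∈ C, BoolClosure C L
  | union : ∀ L M, BoolClosure C L → BoolClosure C M → BoolClosure C (L ∪ M)
  | inter : ∀ L M, BoolClosure C L → BoolClosure C M → BoolClosure C (L ∩ M)
  | compl : ∀ L, BoolClosure C L → BoolClosure C Lᶜ

/-- The language accepted by a DFA. -/
def LangOf {A σ : Type*} (M : DFA A σ) : Set (List A) :=
  {w | M.eval w ∈ M.accept}

/-- A DFA has pattern P₁ if there are words `v, x, y, z`, a letter `a` and
states `s₁, s₂, s₃` with `ya ⊑ v`, `δ*(s₀,x) = δ*(s₁,v) = s₁`, `δ*(s₁,y) = s₂`,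
`δ(s₂,a) = s₃` and `δ*(s₂,z) ∈ S' ↔ δ*(s₃,z) ∉ S'`. -/
def HasPatternP1 {A σ : Type*} (M : DFA A σ) : Prop :=
  ∃ (v x y z : List A) (a : A) (s1 s2 s3 : σ),
    (y ++ [a]).Sublist v ∧
    M.evalFrom M.start x = s1 ∧ M.evalFrom s1 v = s1 ∧
    M.evalFrom s1 y = s2 ∧ M.step s2 a = s3 ∧
    (M.evalFrom s2 z ∈ M.accept ↔ M.evalFrom s3 z ∉ M.accept)

/-- A DFA has pattern P₂ if there are words `u, x, z, z'`, a letter `a` and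
states `s₁, s₂, s₃, s₄` with `az ⊑ u`, `δ*(s₀,x) = s₁`, `δ(s₁,a) = s₂`,
`δ*(s₁,z) = δ*(s₃,u) = s₃`, `δ*(s₂,z) = δ*(s₄,u) = s₄` and
`δ*(s₃,z') ∈ S' ↔ δ*(s₄,z') ∉ S'`. -/
def HasPatternP2 {A σ : Type*} (M : DFA A σ) : Prop :=
  ∃ (u x z z' : List A) (a : A) (s1 s2 s3 s4 : σ),
    (a :: z).Sublist u ∧
    M.evalFrom M.start x = s1 ∧ M.step s1 a = s2 ∧
    M.evalFrom s1 z = s3 ∧ M.evalFrom s3 u = s3 ∧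
    M.evalFrom s2 z = s4 ∧ M.evalFrom s4 u = s4 ∧
    (M.evalFrom s3 z' ∈ M.accept ↔ M.evalFrom s4 z' ∉ M.accept)

/-- A DFA has pattern P₃ if there are words `u, v, x, y, z, z'`, a letter `a`
and states `s₁, …, s₅` with `ya ⊑ v` or `az ⊑ u`, `δ*(s₀,x) = δ*(s₁,v) = s₁`,
`δ*(s₁,y) = s₂`, `δ(s₂,a) = s₃`, `δ*(s₂,z) = δ*(s₄,u) = s₄`,
`δ*(s₃,z) = δ*(s₅,u) = s₅` and `δ*(s₄,z') ∈ S' ↔ δ*(s₅,z') ∉ S'`. -/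
def HasPatternP3 {A σ : Type*} (M : DFA A σ) : Prop :=
  ∃ (u v x y z z' : List A) (a : A) (s1 s2 s3 s4 s5 : σ),
    ((y ++ [a]).Sublist v ∨ (a :: z).Sublist u) ∧
    M.evalFrom M.start x = s1 ∧ M.evalFrom s1 v = s1 ∧
    M.evalFrom s1 y = s2 ∧ M.step s2 a = s3 ∧
    M.evalFrom s2 z = s4 ∧ M.evalFrom s4 u = s4 ∧
    M.evalFrom s3 z = s5 ∧ M.evalFrom s5 u = s5 ∧
    (M.evalFrom s4 z' ∈ M.accept ↔ M.evalFrom s5 z' ∉ M.accept)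

/-! ### Words with the same short scattered subwords -/

/-- Two words are equivalent for `F` if they have the same scattered subwords in `F`. -/
def SubwordEquiv {A : Type*} (F : Set (List A)) (u v : List A) : Prop :=
  ∀ w ∈ F, (w.Sublist u ↔ w.Sublist v)

theorem SubwordEquiv.trans {A : Type*} {F : Set (List A)} {u v w : List A}
    (h : SubwordEquiv F u v) (h' : SubwordEquiv F v w) : SubwordEquiv F u w :=
  fun x hx => (h x hx).trans (h' x hx)

theorem BoolClosure.empty_language {A : Type*} : BoolClosure (LhalfClass A) ∅ :=
  .base _ ⟨∅, by simp⟩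

theorem BoolClosure.superwords {A : Type*} (w : List A) :
    BoolClosure (LhalfClass A) {v | w.Sublist v} :=
  .base _ ⟨{w}, by simp⟩

/-- A language saturated for a finite set of subword tests lies in the boolean closure. -/
theorem boolClosure_of_saturated {A : Type*} {F : Set (List A)} (hF : F.Finite) :
    ∀ L : Set (List A), (∀ u v, SubwordEquiv F u v → u ∈ L → v ∈ L) →
      BoolClosure (LhalfClass A) L := by
  induction F, hF using Set.Finite.induction_on with
  | empty =>
    intro L hL
    by_cases hne : ∃ u, u ∈ L
    · obtain ⟨u, hu⟩ := hne
      have : L = (∅ : Set (List A))ᶜ := by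
        ext v
        simpa using hL u v (fun w hw => hw.elim) hu
      rw [this]
      exact .compl _ .empty_language
    · have : L = ∅ := by
        ext v
        simpa using fun hv => hne ⟨v, hv⟩
      rw [this]
      exact .empty_language
  | @insert w F _ _ ih =>
    intro L hL
    have key : L =
        ({u | ∃ v ∈ L, w.Sublist v ∧ SubwordEquiv F v u} ∩ {u | w.Sublist u}) ∪
        ({u | ∃ v ∈ L, ¬ w.Sublist v ∧ SubwordEquiv F v u} ∩ {u | w.Sublist u}ᶜ) := by
      ext u
      constructor
      · intro hu
        by_cases hw : w.Sublist u
        · exact Or.inl ⟨⟨u, hu, hw, fun _ _ => Iff.rfl⟩, hw⟩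
        · exact Or.inr ⟨⟨u, hu, hw, fun _ _ => Iff.rfl⟩, hw⟩
      · rintro (⟨⟨v, hv, hwv, hvu⟩, hwu⟩ | ⟨⟨v, hv, hwv, hvu⟩, hwu⟩)
        · refine hL v u ?_ hv
          rintro x (rfl | hx)
          · exact iff_of_true hwv hwu
          · exact hvu x hx
        · refine hL v u ?_ hv
          rintro x (rfl | hx)
          · exact iff_of_false hwv hwu
          · exact hvu x hx
    rw [key]
    refine .union _ _ (.inter _ _ (ih _ ?_) (.superwords w))
      (.inter _ _ (ih _ ?_) (.compl _ (.superwords w)))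
    · rintro u u' huu' ⟨v, hv, hw, hvu⟩
      exact ⟨v, hv, hw, hvu.trans huu'⟩
    · rintro u u' huu' ⟨v, hv, hw, hvu⟩
      exact ⟨v, hv, hw, hvu.trans huu'⟩

/-- Membership in a language of the boolean closure is determined by the short subwords. -/
theorem BoolClosure.exists_saturated {A : Type*} {L : Set (List A)}
    (h : BoolClosure (LhalfClass A) L) :
    ∃ n : ℕ, ∀ u v, SubwordEquiv {w | w.length ≤ n} u v → (u ∈ L ↔ v ∈ L) := by
  induction h with
  | base L hL =>
    obtain ⟨W, rfl⟩ := hL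
    refine ⟨W.sup List.length, fun u v huv => ?_⟩
    simp only [Set.mem_iUnion, Set.mem_ofPred_eq]
    refine exists_congr fun w => exists_congr fun hw => huv w ?_
    exact Finset.le_sup (f := List.length) hw
  | union L M _ _ ihL ihM =>
    obtain ⟨m, hm⟩ := ihL
    obtain ⟨n, hn⟩ := ihM
    refine ⟨max m n, fun u v huv => or_congr (hm u v fun w hw => huv w ?_)
      (hn u v fun w hw => huv w ?_)⟩
    · exact (le_max_of_le_left hw : w.length ≤ max m n)
    · exact (le_max_of_le_right hw : w.length ≤ max m n)
  | inter L M _ _ ihL ihM =>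
    obtain ⟨m, hm⟩ := ihL
    obtain ⟨n, hn⟩ := ihM
    refine ⟨max m n, fun u v huv => and_congr (hm u v fun w hw => huv w ?_)
      (hn u v fun w hw => huv w ?_)⟩
    · exact (le_max_of_le_left hw : w.length ≤ max m n)
    · exact (le_max_of_le_right hw : w.length ≤ max m n)
  | compl L _ ih =>
    obtain ⟨n, hn⟩ := ih
    exact ⟨n, fun u v huv => not_congr (hn u v huv)⟩

/-! ### Powers of words -/

/-- The `n`-th power of a word. -/
def wordPow {A : Type*} (w : List A) (n : ℕ) : List A := (List.replicate n w).flatten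

theorem wordPow_succ {A : Type*} (w : List A) (n : ℕ) : wordPow w (n + 1) = w ++ wordPow w n := by
  simp [wordPow, List.replicate_succ]

theorem wordPow_add {A : Type*} (w : List A) (m n : ℕ) :
    wordPow w (m + n) = wordPow w m ++ wordPow w n := by
  simp [wordPow, ← List.replicate_append_replicate]

theorem sublist_wordPow {A : Type*} {v w : List A} {n : ℕ} (hv : ∀ c ∈ w, c ∈ v)
    (hn : w.length ≤ n) : w.Sublist (wordPow v n) := by
  induction w generalizing n with
  | nil => simp
  | cons c w ih =>
    obtain ⟨n, rfl⟩ : ∃ k, n = k + 1 := ⟨n - 1, by simp at hn; omega⟩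
    rw [wordPow_succ]
    exact List.Sublist.append (List.singleton_sublist.2 (hv c (by simp)))
      (ih (fun d hd => hv d (by simp [hd])) (by simpa using hn))

theorem mem_of_mem_wordPow {A : Type*} {v : List A} {n : ℕ} {c : A} (h : c ∈ wordPow v n) :
    c ∈ v := by
  simp only [wordPow, List.mem_flatten, List.mem_replicate] at h
  obtain ⟨l, ⟨_, rfl⟩, hc⟩ := h
  exact hc

theorem evalFrom_wordPow {A σ : Type*} (M : DFA A σ) (w : List A) (n : ℕ) (s : σ) :
    M.evalFrom s (wordPow w n) = (fun t => M.evalFrom t w)^[n] s := by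
  induction n generalizing s with
  | zero => simp [wordPow]
  | succ n ih => rw [wordPow_succ, DFA.evalFrom_of_append, ih, Function.iterate_succ_apply]

theorem evalFrom_wordPow_of_loop {A σ : Type*} (M : DFA A σ) {w : List A} {s : σ}
    (h : M.evalFrom s w = s) (n : ℕ) : M.evalFrom s (wordPow w n) = s := by
  rw [evalFrom_wordPow]
  exact Function.iterate_fixed h n

/-- In a finite automaton some power of a word leads every state into a cycle
labelled by another power of this word. -/
theorem exists_evalFrom_wordPow_loop {A σ : Type*} [Finite σ] (M : DFA A σ) (w : List A) :
    ∃ i d : ℕ, 0 < d ∧ ∀ s k,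
      M.evalFrom (M.evalFrom s (wordPow w i)) (wordPow w (d * k)) =
        M.evalFrom s (wordPow w i) := by
  obtain ⟨i, j, hij, h⟩ : ∃ i j : ℕ, i < j ∧
      (fun s => M.evalFrom s (wordPow w i)) = fun s => M.evalFrom s (wordPow w j) := by
    obtain ⟨i, j, hne, h⟩ := Finite.exists_ne_map_eq_of_infinite
      fun n : ℕ => fun s => M.evalFrom s (wordPow w n)
    rcases lt_or_gt_of_ne hne with hlt | hlt
    · exact ⟨i, j, hlt, h⟩
    · exact ⟨j, i, hlt, h.symm⟩
  refine ⟨i, j - i, by omega, fun s k => ?_⟩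
  induction k with
  | zero => simp [wordPow]
  | succ k ih =>
    rw [Nat.mul_succ, wordPow_add, DFA.evalFrom_of_append, ih, ← DFA.evalFrom_of_append,
      ← wordPow_add, show i + (j - i) = j by omega]
    exact (congrFun h s).symm

/-! ### The pattern excludes membership in the boolean closure -/

theorem sublist_of_sublist_append {A : Type*} {n : ℕ} {w p m m' r : List A}
    (hw : w.length ≤ n) (hm : ∀ w' : List A, w'.length ≤ n → w'.Sublist m → w'.Sublist m')
    (h : w.Sublist (p ++ m ++ r)) : w.Sublist (p ++ m' ++ r) := by
  obtain ⟨w₁₂, w₃, rfl, h₁₂, h₃⟩ := List.sublist_append_iff.1 h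
  obtain ⟨w₁, w₂, rfl, h₁, h₂⟩ := List.sublist_append_iff.1 h₁₂
  simp only [List.length_append] at hw
  exact (h₁.append (hm w₂ (by omega) h₂)).append h₃

theorem not_hasPatternP3_of_boolClosure {A σ : Type*} (M : DFA A σ)
    (h : BoolClosure (LhalfClass A) (LangOf M)) : ¬ HasPatternP3 M := by
  rintro ⟨u, v, x, y, z, z', a, s1, s2, s3, s4, s5, hsub, h1, hv, h2, h3, h4, h4u, h5, h5u, hz⟩
  obtain ⟨n, hn⟩ := h.exists_saturated
  have hX : M.eval (x ++ wordPow v n ++ y ++ z ++ wordPow u n ++ z') = M.evalFrom s4 z' := by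
    simp only [DFA.eval, DFA.evalFrom_of_append, h1, evalFrom_wordPow_of_loop M hv, h2, h4,
      evalFrom_wordPow_of_loop M h4u]
  have hY : M.eval (x ++ wordPow v n ++ y ++ [a] ++ z ++ wordPow u n ++ z') =
      M.evalFrom s5 z' := by
    simp only [DFA.eval, DFA.evalFrom_of_append, h1, evalFrom_wordPow_of_loop M hv, h2,
      DFA.evalFrom_singleton, h3, h5, evalFrom_wordPow_of_loop M h5u]
  have key := hn (x ++ wordPow v n ++ y ++ z ++ wordPow u n ++ z')
    (x ++ wordPow v n ++ y ++ [a] ++ z ++ wordPow u n ++ z') ?_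
  · simp only [LangOf, Set.mem_ofPred_eq, hX, hY] at key
    tauto
  · intro w hw
    refine ⟨fun hwX => hwX.trans (by simp), fun hwY => ?_⟩
    rcases hsub with hsub | hsub
    · have := sublist_of_sublist_append (p := x) (m := wordPow v n ++ y ++ [a])
        (m' := wordPow v n ++ y) (r := z ++ wordPow u n ++ z') hw ?_ (by simpa using hwY)
      · simpa using this
      · intro w' hw' hsw
        refine (sublist_wordPow (v := v) (fun c hc => ?_) hw').trans
          (List.sublist_append_left _ _)
        have := hsw.subset hc
        rw [List.append_assoc, List.mem_append] at this
        exact this.elim mem_of_mem_wordPow fun h => hsub.subset h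
    · have := sublist_of_sublist_append (p := x ++ wordPow v n ++ y)
        (m := [a] ++ z ++ wordPow u n) (m' := z ++ wordPow u n) (r := z') hw ?_
        (by simpa using hwY)
      · simpa using this
      · intro w' hw' hsw
        refine (sublist_wordPow (v := u) (fun c hc => ?_) hw').trans
          (List.sublist_append_right _ _)
        have := hsw.subset hc
        rw [List.mem_append] at this
        exact this.elim (fun h => hsub.subset h) mem_of_mem_wordPow

/-! ### The letters at which the state changes -/

open Classical in
/-- The letters of a word read from the state `p` at which the state changes. -/
noncomputable def descents {A P : Type*} (δ : P → A → P) : P → List A → List A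
  | _, [] => []
  | p, c :: u => if δ p c = p then descents δ p u else c :: descents δ (δ p c) u

section Descents

variable {A P : Type*} {δ : P → A → P}

theorem descents_cons_of_eq {p : P} {c : A} (h : δ p c = p) (u : List A) :
    descents δ p (c :: u) = descents δ p u := by
  simp [descents, h]

theorem descents_cons_of_ne {p : P} {c : A} (h : δ p c ≠ p) (u : List A) :
    descents δ p (c :: u) = c :: descents δ (δ p c) u := by
  simp [descents, h]

theorem descents_sublist (p : P) (u : List A) : (descents δ p u).Sublist u := by
  induction u generalizing p with
  | nil => simp [descents]
  | cons c u ih =>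
    by_cases h : δ p c = p
    · rw [descents_cons_of_eq h]
      exact (ih p).cons c
    · rw [descents_cons_of_ne h]
      exact (ih _).cons_cons c

theorem descents_append (p : P) (u v : List A) :
    descents δ p (u ++ v) = descents δ p u ++ descents δ (u.foldl δ p) v := by
  induction u generalizing p with
  | nil => simp [descents]
  | cons c u ih =>
    by_cases h : δ p c = p
    · simp [descents_cons_of_eq h, ih, h]
    · simp [descents_cons_of_ne h, ih]

theorem foldl_descents (p : P) (u : List A) : (descents δ p u).foldl δ p = u.foldl δ p := by
  induction u generalizing p with
  | nil => simp [descents]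
  | cons c u ih =>
    by_cases h : δ p c = p
    · simp [descents_cons_of_eq h, ih, h]
    · simp [descents_cons_of_ne h, ih]

theorem foldl_eq_self {p : P} {u : List A} (h : ∀ c ∈ u, δ p c = p) : u.foldl δ p = p := by
  induction u with
  | nil => rfl
  | cons c u ih =>
    rw [List.foldl_cons, h c (by simp)]
    exact ih fun d hd => h d (by simp [hd])

theorem descents_eq_nil_iff {p : P} {u : List A} :
    descents δ p u = [] ↔ ∀ c ∈ u, δ p c = p := by
  induction u with
  | nil => simp [descents]
  | cons c u ih =>
    by_cases h : δ p c = p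
    · simp [descents_cons_of_eq h, ih, h]
    · simp [descents_cons_of_ne h, h]

theorem exists_of_descents_eq_cons {p : P} {u a : List A} {c : A}
    (h : descents δ p u = c :: a) :
    ∃ s t, u = s ++ c :: t ∧ (∀ d ∈ s, δ p d = p) ∧ δ p c ≠ p ∧ descents δ (δ p c) t = a := by
  induction u with
  | nil => simp [descents] at h
  | cons d u ih =>
    by_cases hd : δ p d = p
    · rw [descents_cons_of_eq hd] at h
      obtain ⟨s, t, rfl, hs, hc, ht⟩ := ih h
      exact ⟨d :: s, t, rfl, by simpa [hd] using hs, hc, ht⟩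
    · rw [descents_cons_of_ne hd] at h
      obtain ⟨rfl, rfl⟩ := List.cons.inj h
      exact ⟨[], u, rfl, by simp, hd, rfl⟩

/-- The descents form the leftmost embedding of the word they spell. -/
theorem prefix_descents_of_sublist {p : P} {x y e r : List A}
    (h : descents δ p (x ++ y) = e ++ r) (he : e.Sublist x) : e <+: descents δ p x := by
  induction x generalizing p e with
  | nil => simp [List.sublist_nil.1 he]
  | cons c x ih =>
    rcases e with - | ⟨d, e⟩
    · exact List.prefix_append [] _
    by_cases hc : δ p c = p
    · rw [List.cons_append, descents_cons_of_eq hc] at h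
      rw [descents_cons_of_eq hc]
      obtain ⟨_, _, _, _, hd, _⟩ := exists_of_descents_eq_cons h
      refine ih h ?_
      rcases List.sublist_cons_iff.1 he with he | ⟨r, hr, _⟩
      · exact he
      · obtain ⟨rfl, _⟩ := List.cons.inj hr
        exact absurd hc hd
    · rw [List.cons_append, descents_cons_of_ne hc, List.cons_append] at h
      obtain ⟨rfl, h'⟩ := List.cons.inj h
      rw [descents_cons_of_ne hc, List.prefix_cons_inj]
      exact ih h' (List.cons_sublist_cons.1 he)

/-- If the automaton can only leave a state for good, then the number of descents is at most
the number of accessible states. -/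
theorem length_descents_le (p : P) (u : List A)
    (hfin : (Set.range fun w : List A => w.foldl δ p).Finite)
    (htriv : ∀ x w : List A, ∀ c ∈ w, w.foldl δ (x.foldl δ p) = x.foldl δ p →
      δ (x.foldl δ p) c = x.foldl δ p) :
    (descents δ p u).length ≤ (Set.range fun w : List A => w.foldl δ p).ncard := by
  induction u generalizing p with
  | nil => simp [descents]
  | cons c u ih =>
    by_cases hc : δ p c = p
    · rw [descents_cons_of_eq hc]
      exact ih p hfin htriv
    · rw [descents_cons_of_ne hc, List.length_cons]
      have hsub : (Set.range fun w : List A => w.foldl δ (δ p c)) ⊂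
          Set.range fun w : List A => w.foldl δ p := by
        refine (Set.ssubset_iff_of_subset ?_).2 ⟨p, ⟨[], rfl⟩, ?_⟩
        · rintro _ ⟨w, rfl⟩
          exact ⟨c :: w, rfl⟩
        · rintro ⟨w, hw⟩
          exact hc (htriv [] (c :: w) c (by simp) hw)
      have := ih (δ p c) (hfin.subset hsub.subset) fun x => htriv (c :: x)
      have := Set.ncard_lt_ncard hsub hfin
      omega

end Descents

/-! ### Merging descents from the left and from the right -/

theorem cons_sublist_append_iff {A : Type*} {c : A} {s t w : List A} (hc : c ∉ s) :
    (c :: w).Sublist (s ++ t) ↔ (c :: w).Sublist t := by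
  induction s with
  | nil => simp
  | cons d s ih =>
    simp only [List.mem_cons, not_or] at hc
    rw [List.cons_append, List.sublist_cons_iff, ih hc.2]
    refine ⟨?_, Or.inl⟩
    rintro (h | ⟨r, hr, _⟩)
    · exact h
    · exact absurd (List.cons.inj hr).1 hc.1

theorem cons_sublist_append_cons_iff {A : Type*} {c : A} {s t w : List A} (hc : c ∉ s) :
    (c :: w).Sublist (s ++ c :: t) ↔ w.Sublist t := by
  rw [cons_sublist_append_iff hc, List.cons_sublist_cons]

/-- The position of the first letter in the rightmost embedding of a subword. -/
theorem exists_rightmost_split {A : Type*} {c : A} {b w : List A} (h : (c :: b).Sublist w) :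
    ∃ s t, w = s ++ c :: t ∧ b.Sublist t ∧ ¬ (c :: b).Sublist t := by
  induction w with
  | nil => simp at h
  | cons d w ih =>
    by_cases hw : (c :: b).Sublist w
    · obtain ⟨s, t, rfl, h₁, h₂⟩ := ih hw
      exact ⟨d :: s, t, rfl, h₁, h₂⟩
    · rcases List.sublist_cons_iff.1 h with h | ⟨r, hr, h⟩
      · exact absurd h hw
      · obtain ⟨rfl, rfl⟩ := List.cons.inj hr
        exact ⟨[], w, rfl, h, hw⟩

section Merge

variable {A P Q : Type*} {δ : P → A → P} {ε : Q → A → Q}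

theorem descents_of_rightmost_split {q : Q} {c : A} {b s t : List A}
    (h : descents ε q (s ++ c :: t).reverse = (c :: b).reverse)
    (hb : b.Sublist t) (hcb : ¬ (c :: b).Sublist t) :
    descents ε q t.reverse = b.reverse ∧
      (s ++ c :: t).reverse.foldl ε q = ε (t.reverse.foldl ε q) c := by
  simp only [List.reverse_append, List.reverse_cons, List.append_assoc] at h ⊢
  have ht : descents ε q t.reverse = b.reverse := by
    obtain ⟨r, hr⟩ := prefix_descents_of_sublist h hb.reverse
    rw [descents_append, ← hr, List.append_assoc, List.append_cancel_left_eq] at h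
    rcases List.append_eq_singleton_iff.1 h with ⟨rfl, _⟩ | ⟨rfl, _⟩
    · simpa using hr.symm
    · refine absurd ?_ hcb
      rw [← List.reverse_sublist, List.reverse_cons, hr]
      exact descents_sublist _ _
  refine ⟨ht, ?_⟩
  rw [descents_append, ht, List.append_cancel_left_eq] at h
  obtain ⟨x, y, hxy, hx, hne, hy⟩ := exists_of_descents_eq_cons h
  rw [List.foldl_append, hxy, List.foldl_append, foldl_eq_self hx, List.foldl_cons,
    foldl_eq_self (descents_eq_nil_iff.1 hy)]

theorem descents_of_sublist_suffix {q : Q} {b s t : List A}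
    (h : descents ε q (s ++ t).reverse = b.reverse) (hb : b.Sublist t) :
    descents ε q t.reverse = b.reverse ∧
      ∀ c ∈ s, ε (t.reverse.foldl ε q) c = t.reverse.foldl ε q := by
  rw [List.reverse_append] at h
  obtain ⟨r, hr⟩ := prefix_descents_of_sublist (r := []) (by simpa using h) hb.reverse
  rw [descents_append, ← hr, List.append_assoc, List.append_right_eq_self,
    List.append_eq_nil_iff] at h
  refine ⟨by rw [← hr, h.1, List.append_nil], fun c hc => ?_⟩
  exact descents_eq_nil_iff.1 h.2 c (by simpa using hc)

/-- If the left descents of `u` and the right descents of `v` are arranged in the same way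
in both words, then some word acts like `u` from the left and like `v` from the right. -/
theorem exists_merge {q : Q} {a b : List A} {p : P} {u v : List A}
    (hu : descents δ p u = a) (hv : descents ε q v.reverse = b.reverse)
    (huv : ∀ α β, α <+: a → β <:+ b → ((α ++ β).Sublist u ↔ (α ++ β).Sublist v)) :
    ∃ W : List A, W.foldl δ p = u.foldl δ p ∧ W.reverse.foldl ε q = v.reverse.foldl ε q := by
  induction hn : a.length + b.length using Nat.strong_induction_on generalizing a b p u v with
  | h n ih => ?_
  have hau : a.Sublist u := hu ▸ descents_sublist _ _
  have hbv : b.Sublist v := by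
    rw [← List.reverse_sublist, ← hv]
    exact descents_sublist _ _
  have hav : a.Sublist v := by
    simpa using (huv a [] List.prefix_rfl List.nil_suffix).1 (by simpa using hau)
  have hbu : b.Sublist u := (huv [] b (List.prefix_append [] _) List.suffix_rfl).2 hbv
  rcases a with - | ⟨c, a⟩
  · refine ⟨b, ?_, by rw [← hv, foldl_descents]⟩
    have := descents_eq_nil_iff.1 hu
    rw [foldl_eq_self this, foldl_eq_self fun d hd => this d (hbu.subset hd)]
  obtain ⟨s, t, rfl, hs, hc, ht⟩ := exists_of_descents_eq_cons hu
  have hcs : c ∉ s := fun h => hc (hs c h)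
  obtain ⟨s', t', rfl, hcs'⟩ := List.eq_append_cons_of_mem (hav.subset List.mem_cons_self)
  have hfu : (s ++ c :: t).foldl δ p = t.foldl δ (δ p c) := by
    rw [List.foldl_append, foldl_eq_self hs, List.foldl_cons]
  have htail : ∀ α β, α <+: a → β <:+ b → ((α ++ β).Sublist t ↔ (α ++ β).Sublist t') := by
    intro α β hα hβ
    have := huv (c :: α) β ((List.prefix_cons_inj c).2 hα) hβ
    rwa [List.cons_append, cons_sublist_append_cons_iff hcs,
      cons_sublist_append_cons_iff hcs'] at this
  by_cases hbt' : b.Sublist t'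
  · rw [List.append_cons] at hv
    obtain ⟨hvt, hstab⟩ := descents_of_sublist_suffix hv hbt'
    obtain ⟨W, hW, hW'⟩ := ih _ (by simp only [← hn, List.length_cons]; omega) ht hvt htail rfl
    refine ⟨c :: W, by rw [hfu, List.foldl_cons, hW], ?_⟩
    rw [List.append_cons, List.reverse_append, List.foldl_append,
      foldl_eq_self fun d hd => hstab d (List.mem_reverse.1 hd), List.reverse_cons,
      List.foldl_append, hW', foldl_eq_self]
    intro d hd
    exact hstab d (List.mem_append_right _ hd)
  rcases b with - | ⟨d, b⟩
  · simp at hbt'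
  have hbt : ¬ (d :: b).Sublist t := fun h =>
    hbt' ((htail [] _ (List.prefix_append [] _) List.suffix_rfl).1 h)
  by_cases hcd : c = d ∧ b.Sublist t'
  · obtain ⟨rfl, hb⟩ := hcd
    obtain ⟨hvt, hfv⟩ := descents_of_rightmost_split hv hb hbt'
    obtain ⟨W, hW, hW'⟩ := ih _ (by simp only [← hn, List.length_cons]; omega) ht hvt
      (fun α β hα hβ => htail α β hα (hβ.trans (List.suffix_cons c b))) rfl
    refine ⟨c :: W, by rw [hfu, List.foldl_cons, hW], ?_⟩
    rw [hfv, List.reverse_cons, List.foldl_append, hW', List.foldl_cons, List.foldl_nil]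
  have hbtt' : b.Sublist t ↔ b.Sublist t' :=
    htail [] b (List.prefix_append [] _) (List.suffix_cons d b)
  have hnot : ∀ {s t x y : List A}, c ∉ s → ¬ (d :: b).Sublist t → ¬ (c = d ∧ b.Sublist t) →
      s ++ c :: t = x ++ d :: y → b.Sublist y → c ∉ x ++ [d] := by
    intro s t x y hcs hdt hcd heq hby hmem
    rcases List.mem_append.1 hmem with hx | hd
    · have : (c :: d :: b).Sublist (x ++ d :: y) :=
        List.Sublist.append (List.singleton_sublist.2 hx) (hby.cons_cons d)
      rw [← heq, cons_sublist_append_cons_iff hcs] at this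
      exact hdt this
    · obtain rfl := List.mem_singleton.1 hd
      have : (c :: b).Sublist (x ++ c :: y) :=
        (hby.cons_cons c).trans (List.sublist_append_right _ _)
      rw [← heq, cons_sublist_append_cons_iff hcs] at this
      exact hcd ⟨rfl, this⟩
  obtain ⟨x, y, hxy, hby, hdby⟩ := exists_rightmost_split hbu
  obtain ⟨x', y', hxy', hby', hdby'⟩ := exists_rightmost_split hbv
  have hcx := hnot hcs hbt (by rwa [hbtt']) hxy hby
  have hcx' := hnot hcs' hbt' hcd hxy' hby'
  have hstab : ∀ e ∈ x ++ [d], δ p e = p := by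
    have hpre : (x ++ [d]) <+: s := by
      rw [List.append_cons x] at hxy
      rcases List.append_eq_append_iff.1 hxy with ⟨r, hr, hr'⟩ | ⟨r, hr, _⟩
      · rcases r with - | ⟨e, r⟩
        · exact ⟨[], by simpa using hr⟩
        · obtain ⟨rfl, _⟩ := List.cons.inj hr'
          exact absurd (by simp [hr]) hcx
      · exact ⟨r, hr.symm⟩
    exact fun e he => hs e (hpre.subset he)
  rw [hxy] at hu huv ⊢
  rw [hxy'] at hv huv ⊢
  obtain ⟨hvy, hfv⟩ := descents_of_rightmost_split hv hby' hdby'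
  have huy : descents δ p y = c :: a := by
    rw [List.append_cons, descents_append, descents_eq_nil_iff.2 hstab, foldl_eq_self hstab] at hu
    exact hu
  obtain ⟨W, hW, hW'⟩ := ih _ (by simp only [← hn, List.length_cons]; omega) huy hvy (by
    intro α β hα hβ
    rcases α with - | ⟨e, α⟩
    · exact iff_of_true (hβ.sublist.trans hby) (hβ.sublist.trans hby')
    · have := huv (e :: α) β hα (hβ.trans (List.suffix_cons d b))
      obtain ⟨rfl, _⟩ := List.cons_prefix_cons.1 hα
      rwa [List.append_cons, List.append_cons x', List.cons_append,
        cons_sublist_append_iff hcx, cons_sublist_append_iff hcx'] at this) rfl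
  refine ⟨d :: W, ?_, ?_⟩
  · rw [List.append_cons, List.foldl_append, foldl_eq_self hstab, List.foldl_cons,
      hstab d (by simp), hW]
  · rw [hfv, List.reverse_cons, List.foldl_append, hW', List.foldl_cons, List.foldl_nil]

end Merge

/-! ### Residuals of a language -/

/-- The residual of a language by one letter read from the left. -/
def leftResidual {A : Type*} (L : Set (List A)) (c : A) : Set (List A) := {z | c :: z ∈ L}

/-- The residual of a language by one letter read from the right. -/
def rightResidual {A : Type*} (L : Set (List A)) (c : A) : Set (List A) := {x | x ++ [c] ∈ L}

theorem foldl_leftResidual {A : Type*} (L : Set (List A)) (u : List A) :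
    u.foldl leftResidual L = {z | u ++ z ∈ L} := by
  induction u generalizing L with
  | nil => rfl
  | cons c u ih => rw [List.foldl_cons, ih]; rfl

theorem foldl_rightResidual {A : Type*} (L : Set (List A)) (u : List A) :
    u.foldl rightResidual L = {x | x ++ u.reverse ∈ L} := by
  induction u generalizing L with
  | nil => simp
  | cons c u ih => rw [List.foldl_cons, ih]; simp [rightResidual]

section Residuals

variable {A σ : Type*} [Finite σ] (M : DFA A σ)

theorem finite_range_leftResidual :
    (Set.range fun w : List A => w.foldl leftResidual (LangOf M)).Finite := by
  refine (Set.finite_range fun s : σ => {z | M.evalFrom s z ∈ M.accept}).subset ?_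
  rintro _ ⟨w, rfl⟩
  refine ⟨M.eval w, ?_⟩
  simp [foldl_leftResidual, LangOf, DFA.eval, DFA.evalFrom_of_append]

theorem finite_range_rightResidual :
    (Set.range fun w : List A => w.foldl rightResidual (LangOf M)).Finite := by
  refine (Set.finite_range fun S : Set σ => {x | M.eval x ∈ S}).subset ?_
  rintro _ ⟨w, rfl⟩
  refine ⟨{s | M.evalFrom s w.reverse ∈ M.accept}, ?_⟩
  simp [foldl_rightResidual, LangOf, DFA.eval, DFA.evalFrom_of_append]

variable {M}

theorem leftResidual_eq_self (h : ¬ HasPatternP3 M) (x w : List A) (c : A) (hc : c ∈ w)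
    (hw : w.foldl leftResidual (x.foldl leftResidual (LangOf M)) =
      x.foldl leftResidual (LangOf M)) :
    leftResidual (x.foldl leftResidual (LangOf M)) c = x.foldl leftResidual (LangOf M) := by
  have hpow : ∀ n, (wordPow w n).foldl leftResidual (x.foldl leftResidual (LangOf M)) =
      x.foldl leftResidual (LangOf M) := by
    intro n
    induction n with
    | zero => rfl
    | succ n ih => rw [wordPow_succ, List.foldl_append, hw, ih]
  obtain ⟨i, d, hd, hloop⟩ := exists_evalFrom_wordPow_loop M w
  have hloop1 := hloop (M.eval x) 1
  rw [← hpow i, foldl_leftResidual, foldl_leftResidual]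
  ext z
  by_contra hz
  refine h ⟨[], wordPow w (d * 1), x ++ wordPow w i, [], [], z, c, _, _, _, _, _, Or.inl ?_,
    rfl, ?_, rfl, rfl, rfl, rfl, rfl, rfl, ?_⟩
  · exact sublist_wordPow (by simpa using hc) (by simp; omega)
  · simpa [DFA.evalFrom_of_append, DFA.eval] using hloop1
  · simp only [leftResidual, LangOf, DFA.eval, Set.mem_ofPred_eq, DFA.evalFrom_of_append,
      DFA.evalFrom_cons, DFA.evalFrom_nil] at hz ⊢
    tauto

theorem rightResidual_eq_self (h : ¬ HasPatternP3 M) (z w : List A) (c : A) (hc : c ∈ w)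
    (hw : w.foldl rightResidual (z.foldl rightResidual (LangOf M)) =
      z.foldl rightResidual (LangOf M)) :
    rightResidual (z.foldl rightResidual (LangOf M)) c = z.foldl rightResidual (LangOf M) := by
  have hpow : ∀ n, {x | x ++ wordPow w.reverse n ∈ z.foldl rightResidual (LangOf M)} =
      z.foldl rightResidual (LangOf M) := by
    rw [foldl_rightResidual _ w] at hw
    intro n
    induction n with
    | zero => simp [wordPow]
    | succ n ih =>
      ext x
      have h1 := Set.ext_iff.1 ih (x ++ w.reverse)
      rw [Set.mem_ofPred_eq, List.append_assoc, ← wordPow_succ] at h1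
      exact h1.trans (Set.ext_iff.1 hw x)
  obtain ⟨i, d, hd, hloop⟩ := exists_evalFrom_wordPow_loop M w.reverse
  rw [← hpow i, foldl_rightResidual]
  ext x
  by_contra hx
  refine h ⟨wordPow w.reverse (d * (i + 1)), [], x, [], wordPow w.reverse i, z.reverse, c,
    _, _, _, _, _, Or.inr ?_, rfl, rfl, rfl, rfl, rfl, hloop _ _, rfl, hloop _ _, ?_⟩
  · have hle : i + 1 ≤ d * (i + 1) := Nat.le_mul_of_pos_left _ hd
    obtain ⟨k, hk⟩ := Nat.exists_eq_add_of_le hle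
    rw [hk, wordPow_add, wordPow_succ]
    exact (List.Sublist.append (List.singleton_sublist.2 (by simpa using hc))
      (List.Sublist.refl (wordPow w.reverse i))).trans (List.sublist_append_left _ _)
  · simp only [rightResidual, LangOf, DFA.eval, Set.mem_ofPred_eq, DFA.evalFrom_of_append,
      DFA.evalFrom_cons, DFA.evalFrom_nil] at hx ⊢
    tauto

theorem exists_saturated_of_not_hasPatternP3 (h : ¬ HasPatternP3 M) :
    ∃ n : ℕ, ∀ u v, SubwordEquiv {w | w.length ≤ n} u v → u ∈ LangOf M → v ∈ LangOf M := by
  refine ⟨(Set.range fun w : List A => w.foldl leftResidual (LangOf M)).ncard +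
    (Set.range fun w : List A => w.foldl rightResidual (LangOf M)).ncard,
    fun u v huv hu => ?_⟩
  have hlu := length_descents_le (LangOf M) u (finite_range_leftResidual M)
    (leftResidual_eq_self h)
  have hlv := length_descents_le (LangOf M) v.reverse (finite_range_rightResidual M)
    (rightResidual_eq_self h)
  obtain ⟨W, hW, hW'⟩ := exists_merge (δ := leftResidual) (ε := rightResidual)
    (p := LangOf M) (q := LangOf M) (u := u) (v := v) rfl (List.reverse_reverse _).symm (by
      intro α β hα hβ
      refine huv _ ?_
      have := hα.length_le
      have := hβ.length_le
      rw [List.length_reverse] at this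
      rw [Set.mem_ofPred_eq, List.length_append]
      exact add_le_add (by omega) (this.trans hlv))
  simp only [foldl_leftResidual, foldl_rightResidual, List.reverse_reverse] at hW hW'
  have h1 := Set.ext_iff.1 hW []
  have h2 := Set.ext_iff.1 hW' []
  simp only [Set.mem_ofPred_eq, List.append_nil, List.nil_append] at h1 h2
  exact h2.1 (h1.2 hu)

end Residuals

/-- `L(F) ∈ L₁ = BC(L_{1/2})` iff the DFA `F` does not have pattern P₃. -/
theorem stmt15 {A σ : Type*} [Fintype A] [Fintype σ] (M : DFA A σ) :
    BoolClosure (LhalfClass A) (LangOf M) ↔ ¬ HasPatternP3 M := by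
  refine ⟨not_hasPatternP3_of_boolClosure M, fun h => ?_⟩
  obtain ⟨n, hn⟩ := exists_saturated_of_not_hasPatternP3 h
  exact boolClosure_of_saturated (List.finite_length_le A n) _ hn
end

section
/- Let F be a deterministic finite automaton over a finite alphabet A. If F has pattern P_3, then m^+(L(F)) = ∞, i.e., L(F)^+(m) ≠ ∅ for every m ≥ 0. -/
/-- An infinite alternating chain of word extensions yields arbitrarily long finite ones
starting inside the language. -/
theorem LPlus_nonempty_of_alternating {A : Type*} {L : Set (List A)} (f : ℕ → List A)
    (hsub : ∀ n, (f n).Sublist (f (n + 1))) (halt : ∀ n, f n ∈ L ↔ f (n + 1) ∉ L) (m : ℕ) :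
    (LPlus L m).Nonempty := by
  by_cases h0 : f 0 ∈ L
  · exact ⟨f m, f, h0, fun i _ => hsub i, List.Sublist.refl _, fun i _ => halt i⟩
  · have h1 : f 1 ∈ L := by
      by_contra h1
      exact h0 ((halt 0).2 h1)
    exact ⟨f (m + 1), fun i => f (i + 1), h1, fun i _ => hsub (i + 1), List.Sublist.refl _,
      fun i _ => halt (i + 1)⟩

theorem LPlus_nonempty_of_interleaved {A : Type*} {L : Set (List A)} (b d : ℕ → List A)
    (hbd : ∀ n, (b n).Sublist (d n)) (hdb : ∀ n, (d n).Sublist (b (n + 1)))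
    {p : Prop} (hb : ∀ n, b n ∈ L ↔ p) (hd : ∀ n, d n ∈ L ↔ ¬p) (m : ℕ) :
    (LPlus L m).Nonempty := by
  refine LPlus_nonempty_of_alternating
    (fun n => if n % 2 = 0 then b (n / 2) else d (n / 2)) (fun n => ?_) (fun n => ?_) m
  · rcases Nat.mod_two_eq_zero_or_one n with h | h
    · have h1 : (n + 1) % 2 = 1 := by omega
      have h2 : (n + 1) / 2 = n / 2 := by omega
      simpa [h, h1, h2] using hbd (n / 2)
    · have h1 : (n + 1) % 2 = 0 := by omega
      have h2 : (n + 1) / 2 = n / 2 + 1 := by omega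
      simpa [h, h1, h2] using hdb (n / 2)
  · rcases Nat.mod_two_eq_zero_or_one n with h | h
    · have h1 : (n + 1) % 2 = 1 := by omega
      simp [h, h1, hb, hd]
    · have h1 : (n + 1) % 2 = 0 := by omega
      simp [h, h1, hb, hd]

theorem evalFrom_flatten_replicate {A σ : Type*} (M : DFA A σ) {s : σ} {w : List A}
    (h : M.evalFrom s w = s) (n : ℕ) :
    M.evalFrom s (List.replicate n w).flatten = s := by
  induction n with
  | zero => rfl
  | succ n ih => rw [List.replicate_succ, List.flatten_cons, DFA.evalFrom_of_append, h, ih]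

theorem LPlus_nonempty_of_hasPatternP3 {A σ : Type*} (M : DFA A σ) (h : HasPatternP3 M) (m : ℕ) :
    (LPlus (LangOf M) m).Nonempty := by
  obtain ⟨u, v, x, y, z, z', a, s1, s2, s3, s4, s5, hsub, hx, hv, hy, ha, hz, hu, hz3, hu5,
    hacc⟩ := h
  have hacc' : M.evalFrom s5 z' ∈ M.accept ↔ ¬M.evalFrom s4 z' ∈ M.accept := by tauto
  rcases hsub with hsub | hsub
  · refine LPlus_nonempty_of_interleaved
      (fun n => x ++ ((List.replicate n v).flatten ++ (y ++ (z ++ z'))))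
      (fun n => x ++ ((List.replicate n v).flatten ++ (y ++ ([a] ++ (z ++ z')))))
      (fun n => ?_) (fun n => ?_) (p := M.evalFrom s4 z' ∈ M.accept)
      (fun n => ?_) (fun n => ?_) m
    · simp
    · have key := hsub.append (List.sublist_append_right y (z ++ z'))
      simpa [List.replicate_succ'] using key
    · simp only [LangOf, Set.mem_ofPred_eq, DFA.eval, DFA.evalFrom_of_append, hx,
        evalFrom_flatten_replicate M hv, hy, hz]
    · simp only [LangOf, Set.mem_ofPred_eq, DFA.eval, DFA.evalFrom_of_append, hx,
        evalFrom_flatten_replicate M hv, hy, DFA.evalFrom_singleton, ha, hz3, hacc']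
  · refine LPlus_nonempty_of_interleaved
      (fun n => x ++ (y ++ (z ++ ((List.replicate n u).flatten ++ z'))))
      (fun n => x ++ (y ++ ([a] ++ (z ++ ((List.replicate n u).flatten ++ z')))))
      (fun n => ?_) (fun n => ?_) (p := M.evalFrom s4 z' ∈ M.accept)
      (fun n => ?_) (fun n => ?_) m
    · simp
    · have key := (hsub.trans (List.sublist_append_right z u)).append
        (List.Sublist.refl ((List.replicate n u).flatten ++ z'))
      simpa [List.replicate_succ] using key
    · simp only [LangOf, Set.mem_ofPred_eq, DFA.eval, DFA.evalFrom_of_append, hx, hy, hz,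
        evalFrom_flatten_replicate M hu]
    · simp only [LangOf, Set.mem_ofPred_eq, DFA.eval, DFA.evalFrom_of_append, hx, hy,
        DFA.evalFrom_singleton, ha, hz3, evalFrom_flatten_replicate M hu5, hacc']

theorem mPlus_eq_top {A : Type*} {L : Set (List A)} (h : ∀ m, (LPlus L m).Nonempty) :
    mPlus L = ⊤ := by
  refine ENat.eq_top_iff_forall_ge.2 fun m => ?_
  exact le_iSup₂_of_le m (h m) le_rfl

/-- If a DFA `F` has pattern P₃ then `m⁺(L(F)) = ∞`, i.e. `L(F)⁺(m) ≠ ∅`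
for every `m ≥ 0`. -/
theorem stmt17 {A σ : Type*} [Fintype A] [Fintype σ] (M : DFA A σ)
    (h : HasPatternP3 M) :
    mPlus (LangOf M) = ⊤ ∧ ∀ m : ℕ, (LPlus (LangOf M) m).Nonempty := by
  exact ⟨mPlus_eq_top (LPlus_nonempty_of_hasPatternP3 M h), LPlus_nonempty_of_hasPatternP3 M h⟩
end
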